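/- Let (X, 𝓑, μ, (T_h)_{h ∈ ℤ^d}) be a ℤ^d-system for some d ≥ 1, let E ∈ 𝓑 satisfy μ(E) > 0, and let v_1, …, v_k ∈ ℤ^d. Then there exists a natural number r > 0 such that μ(T_{r v_1} E ∩ … ∩ T_{r v_k} E) > 0. -/

import Mathlib

open MeasureTheory

namespace DensityHalesJewett

open Combinatorics BigOperators

/-! ### Averages over finite types -/

/-- The average of a real function over a finite type. -/
noncomputable def avg {Ω : Type*} [Finite Ω] (f : Ω → ℝ) : ℝ :=
  letI := Fintype.ofFinite Ω
  (∑ x, f x) / Fintype.card Ω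

open Classical in
/-- The real-valued indicator of a proposition. -/
noncomputable def ind (p : Prop) : ℝ := if p then 1 else 0

lemma ind_of_true {p : Prop} (h : p) : ind p = 1 := by simp [ind, h]

lemma ind_of_false {p : Prop} (h : ¬p) : ind p = 0 := by simp [ind, h]

lemma ind_nonneg (p : Prop) : 0 ≤ ind p := by unfold ind; split_ifs <;> norm_num

lemma ind_le_one (p : Prop) : ind p ≤ 1 := by unfold ind; split_ifs <;> norm_num

lemma ind_and (p q : Prop) : ind (p ∧ q) = ind p * ind q := by
  by_cases hp : p <;> by_cases hq : q <;> simp [ind, hp, hq]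

section Avg

variable {Ω Ω' : Type*} [Finite Ω] [Finite Ω']

lemma avg_eq [Fintype Ω] (f : Ω → ℝ) : avg f = (∑ x, f x) / Fintype.card Ω := by
  unfold avg
  congr!

lemma avg_mono {f g : Ω → ℝ} (h : ∀ x, f x ≤ g x) : avg f ≤ avg g := by
  have := Fintype.ofFinite Ω
  rw [avg_eq, avg_eq]
  gcongr with x
  exact h x

lemma avg_add (f g : Ω → ℝ) : avg (fun x ↦ f x + g x) = avg f + avg g := by
  have := Fintype.ofFinite Ω
  rw [avg_eq, avg_eq, avg_eq, Finset.sum_add_distrib, add_div]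

lemma avg_sub (f g : Ω → ℝ) : avg (fun x ↦ f x - g x) = avg f - avg g := by
  have := Fintype.ofFinite Ω
  rw [avg_eq, avg_eq, avg_eq, Finset.sum_sub_distrib, sub_div]

lemma avg_const_mul (c : ℝ) (f : Ω → ℝ) : avg (fun x ↦ c * f x) = c * avg f := by
  have := Fintype.ofFinite Ω
  rw [avg_eq, avg_eq, ← Finset.mul_sum, mul_div_assoc]

lemma avg_mul_const (c : ℝ) (f : Ω → ℝ) : avg (fun x ↦ f x * c) = avg f * c := by
  simp_rw [mul_comm _ c, avg_const_mul]

lemma avg_const [Nonempty Ω] (c : ℝ) : avg (fun _ : Ω ↦ c) = c := by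
  have := Fintype.ofFinite Ω
  rw [avg_eq]
  simp

lemma avg_nonneg {f : Ω → ℝ} (h : ∀ x, 0 ≤ f x) : 0 ≤ avg f := by
  have := Fintype.ofFinite Ω
  rw [avg_eq]
  exact div_nonneg (Finset.sum_nonneg fun x _ ↦ h x) (by positivity)

lemma avg_le_of_le [Nonempty Ω] {f : Ω → ℝ} {c : ℝ} (h : ∀ x, f x ≤ c) : avg f ≤ c :=
  (avg_mono h).trans_eq (avg_const c)

lemma le_avg_of_le [Nonempty Ω] {f : Ω → ℝ} {c : ℝ} (h : ∀ x, c ≤ f x) : c ≤ avg f :=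
  (avg_const c).symm.trans_le (avg_mono h)

lemma exists_le_of_le_avg [Nonempty Ω] {f : Ω → ℝ} {c : ℝ} (h : c ≤ avg f) : ∃ x, c ≤ f x := by
  by_contra! hlt
  have := Fintype.ofFinite Ω
  have h1 : ∑ x, f x < ∑ _x : Ω, c :=
    Finset.sum_lt_sum_of_nonempty Finset.univ_nonempty fun x _ ↦ hlt x
  rw [avg_eq, le_div_iff₀ (by exact_mod_cast Fintype.card_pos)] at h
  simp only [Finset.sum_const, Finset.card_univ, nsmul_eq_mul] at h1
  linarith

lemma exists_of_avg_pos {f : Ω → ℝ} (h : 0 < avg f) : ∃ x, 0 < f x := by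
  by_contra! hle
  have := avg_mono (g := fun _ ↦ 0) hle
  have h0 : avg (fun _ : Ω ↦ (0 : ℝ)) = 0 := by
    have := Fintype.ofFinite Ω
    simp [avg_eq]
  linarith

lemma exists_mem_of_avg_pos {A : Set Ω} (h : 0 < avg fun x ↦ ind (x ∈ A)) : ∃ x, x ∈ A := by
  obtain ⟨x, hx⟩ := exists_of_avg_pos h
  refine ⟨x, ?_⟩
  by_contra hxA
  rw [ind_of_false hxA] at hx
  exact hx.false

lemma avg_sum {κ : Type*} (s : Finset κ) (f : κ → Ω → ℝ) :
    avg (fun x ↦ ∑ i ∈ s, f i x) = ∑ i ∈ s, avg (f i) := by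
  have := Fintype.ofFinite Ω
  simp_rw [avg_eq]
  rw [Finset.sum_comm, Finset.sum_div]

lemma avg_comm (f : Ω → Ω' → ℝ) :
    avg (fun x ↦ avg fun y ↦ f x y) = avg fun y ↦ avg fun x ↦ f x y := by
  have := Fintype.ofFinite Ω
  have := Fintype.ofFinite Ω'
  simp_rw [avg_eq, ← Finset.sum_div]
  rw [Finset.sum_comm, div_right_comm]

lemma avg_equiv (e : Ω ≃ Ω') (f : Ω' → ℝ) : avg (fun x ↦ f (e x)) = avg f := by
  have := Fintype.ofFinite Ω
  have := Fintype.ofFinite Ω'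
  rw [avg_eq, avg_eq, Equiv.sum_comp e f, Fintype.card_congr e]

lemma avg_prod (f : Ω × Ω' → ℝ) : avg f = avg fun x ↦ avg fun y ↦ f (x, y) := by
  have := Fintype.ofFinite Ω
  have := Fintype.ofFinite Ω'
  simp_rw [avg_eq, ← Finset.sum_div]
  rw [Fintype.sum_prod_type, Fintype.card_prod, div_div]
  push_cast
  rw [mul_comm]

lemma avg_sumElim {β ι κ : Type*} [Finite β] [Finite ι] [Finite κ] (f : (ι ⊕ κ → β) → ℝ) :
    avg f = avg fun x : ι → β ↦ avg fun y : κ → β ↦ f (Sum.elim x y) := by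
  rw [← avg_equiv (Equiv.sumArrowEquivProdArrow ι κ β).symm f, avg_prod]
  rfl

/-- Averages of a function supported on the range of an injection. -/
lemma avg_ind_range_mul {e : Ω → Ω'} (he : Function.Injective e) (f : Ω' → ℝ) :
    avg (fun y ↦ ind (y ∈ Set.range e) * f y) =
      (Nat.card Ω / Nat.card Ω' : ℝ) * avg fun x ↦ f (e x) := by
  classical
  have := Fintype.ofFinite Ω
  have := Fintype.ofFinite Ω'
  rw [avg_eq, avg_eq, Nat.card_eq_fintype_card, Nat.card_eq_fintype_card]
  have h1 : ∑ y, ind (y ∈ Set.range e) * f y = ∑ x, f (e x) := by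
    rw [← Finset.sum_image (s := Finset.univ) (g := e) (f := f) fun a _ b _ h ↦ he h]
    rw [← Finset.sum_subset (Finset.subset_univ (Finset.univ.image e))]
    · refine Finset.sum_congr rfl fun y hy ↦ ?_
      rw [ind_of_true (by simpa using hy), one_mul]
    · intro y _ hy
      rw [ind_of_false (by simpa using hy), zero_mul]
  rw [h1]
  rcases isEmpty_or_nonempty Ω with h | h
  · simp
  · have : (Fintype.card Ω : ℝ) ≠ 0 := by exact_mod_cast Fintype.card_ne_zero
    field_simp

end Avg

/-! ### Combinatorial subspaces -/

section Subspaces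

variable {β ι κ η ζ : Type*}

instance finite_subspace [Finite η] [Finite β] [Finite ι] : Finite (Subspace η β ι) :=
  Finite.of_injective Subspace.idxFun fun _ _ h ↦ Subspace.ext h

instance finite_line [Finite β] [Finite ι] : Finite (Line β ι) :=
  Finite.of_injective Line.idxFun fun _ _ h ↦ Line.ext h

lemma subspace_injective (S : Subspace η β ι) : Function.Injective S := by
  intro z w h
  funext e
  obtain ⟨i, hi⟩ := S.proper e
  have := congrFun h i
  rwa [Subspace.apply_inr hi, Subspace.apply_inr hi] at this

/-- A subspace of a subspace. -/
def compSubspace (S : Subspace η β ι) (R : Subspace ζ β η) : Subspace ζ β ι where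
  idxFun i := (S.idxFun i).elim Sum.inl R.idxFun
  proper e := by
    obtain ⟨j, hj⟩ := R.proper e
    obtain ⟨i, hi⟩ := S.proper j
    exact ⟨i, by simp [hi, hj]⟩

@[simp] lemma compSubspace_apply (S : Subspace η β ι) (R : Subspace ζ β η) (z : ζ → β) :
    compSubspace S R z = S (R z) := by
  funext i
  simp only [Subspace.apply_def, compSubspace]
  cases S.idxFun i <;> simp [Subspace.apply_def]

/-- The image of a line in a subspace. -/
def compLine (S : Subspace η β ι) (l : Line β η) : Line β ι where
  idxFun i := (S.idxFun i).elim some l.idxFun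
  proper := by
    obtain ⟨j, hj⟩ := l.proper
    obtain ⟨i, hi⟩ := S.proper j
    exact ⟨i, by simp [hi, hj]⟩

@[simp] lemma compLine_apply (S : Subspace η β ι) (l : Line β η) (a : β) :
    compLine S l a = S (l a) := by
  funext i
  simp only [Subspace.apply_def, compLine, Line.apply_def]
  cases S.idxFun i <;> simp

/-- A subspace of `ι → β` and a point of `κ → β` give a subspace of `ι ⊕ κ → β`. -/
def horizontal (S : Subspace η β ι) (y : κ → β) : Subspace η β (ι ⊕ κ) where
  idxFun := Sum.elim S.idxFun (Sum.inl ∘ y)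
  proper e := (S.proper e).elim fun i hi ↦ ⟨Sum.inl i, hi⟩

@[simp] lemma horizontal_apply (S : Subspace η β ι) (y : κ → β) (z : η → β) :
    horizontal S y z = Sum.elim (S z) y := by
  funext i
  cases i <;> rfl

/-- A point of `ι → β` and a subspace of `κ → β` give a subspace of `ι ⊕ κ → β`. -/
def vertical (x : ι → β) (S : Subspace η β κ) : Subspace η β (ι ⊕ κ) where
  idxFun := Sum.elim (Sum.inl ∘ x) S.idxFun
  proper e := (S.proper e).elim fun i hi ↦ ⟨Sum.inr i, hi⟩

@[simp] lemma vertical_apply (x : ι → β) (S : Subspace η β κ) (z : η → β) :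
    vertical x S z = Sum.elim x (S z) := by
  funext i
  cases i <;> rfl

/-- Some `η`-dimensional subspace sees at least the average of a given function. -/
lemma exists_subspace_avg_le [Finite β] [Nonempty β] [Finite η] [Finite ι]
    (h : Nat.card η ≤ Nat.card ι) (g : (ι → β) → ℝ) :
    ∃ S : Subspace η β ι, avg g ≤ avg fun z ↦ g (S z) := by
  classical
  have := Fintype.ofFinite η
  have := Fintype.ofFinite ι
  rw [Nat.card_eq_fintype_card, Nat.card_eq_fintype_card] at h
  obtain ⟨f⟩ := Function.Embedding.nonempty_of_card_le h
  let e : η ⊕ ↑(Set.range f)ᶜ ≃ ι :=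
    ((Equiv.ofInjective f f.injective).sumCongr (Equiv.refl _)).trans
      (Equiv.Set.sumCompl (Set.range f))
  have h1 : avg g = avg fun y : ↑(Set.range f)ᶜ → β ↦ avg fun x : η → β ↦
      g (Sum.elim x y ∘ e.symm) := by
    rw [avg_comm, ← avg_sumElim fun w ↦ g (w ∘ e.symm), ← avg_equiv (e.arrowCongr (Equiv.refl β)) g]
    rfl
  obtain ⟨y, hy⟩ := exists_le_of_le_avg h1.le
  refine ⟨⟨fun i ↦ (e.symm i).elim Sum.inr (Sum.inl ∘ y), fun j ↦ ⟨e (Sum.inl j), by simp⟩⟩, ?_⟩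
  refine hy.trans_eq (congrArg avg (funext fun z ↦ congrArg g (funext fun i ↦ ?_)))
  simp only [Subspace.apply_def, Function.comp_apply]
  cases e.symm i <;> simp

end Subspaces

/-! ### The density Hales-Jewett property and its first consequences -/

/-- The density Hales-Jewett property of a finite alphabet. -/
def HasDensityLines (α : Type) [Finite α] : Prop :=
  ∀ δ : ℝ, 0 < δ → ∃ (ι : Type) (_ : Finite ι), ∀ A : Set (ι → α),
    δ ≤ avg (fun w ↦ ind (w ∈ A)) → ∃ l : Line α ι, ∀ a, l a ∈ A

/-- If every `y` with `δ ≤ F y` is related to some `l` and `F` is large on average, then some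
`l` is related to many `y`. -/
lemma exists_popular {Y L : Type*} [Finite Y] [Nonempty Y] [Finite L] (P : L → Y → Prop)
    (F : Y → ℝ) {δ : ℝ} (hδ : 0 < δ) (hF : ∀ y, F y ≤ 1) (hFavg : 2 * δ ≤ avg F)
    (h : ∀ y, δ ≤ F y → ∃ l, P l y) :
    ∃ l, δ / (Nat.card L + 1) ≤ avg fun y ↦ ind (P l y) := by
  have := Fintype.ofFinite L
  by_contra! hlt
  have h1 : ∀ y, F y ≤ δ + ∑ l, ind (P l y) := by
    intro y
    by_cases hy : δ ≤ F y
    · obtain ⟨l, hl⟩ := h y hy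
      have : ind (P l y) ≤ ∑ l, ind (P l y) :=
        Finset.single_le_sum (f := fun l ↦ ind (P l y)) (fun l _ ↦ ind_nonneg _)
          (Finset.mem_univ l)
      rw [ind_of_true hl] at this
      linarith [hF y]
    · have : 0 ≤ ∑ l, ind (P l y) := Finset.sum_nonneg fun l _ ↦ ind_nonneg _
      linarith
  have h2 := avg_mono h1
  rw [avg_add, avg_const, avg_sum] at h2
  have h3 : ∑ l, avg (fun y ↦ ind (P l y)) ≤ ∑ _l : L, δ / (Nat.card L + 1) :=
    Finset.sum_le_sum fun l _ ↦ (hlt l).le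
  rw [Finset.sum_const, nsmul_eq_mul, Finset.card_univ, ← Nat.card_eq_fintype_card] at h3
  have h4 : (Nat.card L : ℝ) * (δ / (Nat.card L + 1)) < δ := by
    rw [mul_div_assoc', div_lt_iff₀ (by positivity)]
    nlinarith
  linarith

section FirstConsequences

variable {α : Type} [Finite α]

lemma HasDensityLines.exists_dense_line [Nonempty α] (hα : HasDensityLines α) {δ : ℝ}
    (hδ : 0 < δ) :
    ∃ (ι : Type) (_ : Finite ι), ∃ θ > 0, ∀ (Y : Type) [Finite Y] [Nonempty Y]
      (A : (ι → α) → Set Y), (∀ x, δ ≤ avg fun y ↦ ind (y ∈ A x)) →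
      ∃ l : Line α ι, θ ≤ avg fun y ↦ ind (∀ a, y ∈ A (l a)) := by
  obtain ⟨ι, _, hι⟩ := hα (δ / 2) (by positivity)
  refine ⟨ι, ‹_›, δ / 2 / (Nat.card (Line α ι) + 1), by positivity, fun Y _ _ A hA ↦ ?_⟩
  refine exists_popular (fun (l : Line α ι) y ↦ ∀ a, y ∈ A (l a))
    (fun y ↦ avg fun x ↦ ind (y ∈ A x)) (by positivity)
    (fun y ↦ avg_le_of_le fun x ↦ ind_le_one _) ?_ (fun y hy ↦ hι {x | y ∈ A x} hy)
  rw [avg_comm, mul_div_cancel₀ _ two_ne_zero]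
  exact le_avg_of_le hA

lemma HasDensityLines.exists_subspace [Nonempty α] (hα : HasDensityLines α) (n : ℕ) :
    ∀ δ : ℝ, 0 < δ → ∃ (ι : Type) (_ : Finite ι), ∀ A : Set (ι → α),
      δ ≤ avg (fun w ↦ ind (w ∈ A)) → ∃ S : Subspace (Fin n) α ι, ∀ z, S z ∈ A := by
  induction n with
  | zero =>
    intro δ hδ
    refine ⟨Unit, inferInstance, fun A hA ↦ ?_⟩
    obtain ⟨w, hw⟩ := exists_mem_of_avg_pos (hδ.trans_le hA)
    exact ⟨⟨fun i ↦ Sum.inl (w i), fun e ↦ e.elim0⟩, fun z ↦ hw⟩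
  | succ n ih =>
    intro δ hδ
    obtain ⟨ι, _, hι⟩ := hα (δ / 2) (by positivity)
    obtain ⟨κ, _, hκ⟩ := ih (δ / 2 / (Nat.card (Line α ι) + 1)) (by positivity)
    refine ⟨ι ⊕ κ, inferInstance, fun A hA ↦ ?_⟩
    obtain ⟨l, hl⟩ := exists_popular (fun (l : Line α ι) (y : κ → α) ↦ ∀ a, Sum.elim (l a) y ∈ A)
      (fun y ↦ avg fun x ↦ ind (Sum.elim x y ∈ A)) (δ := δ / 2) (by positivity)
      (fun y ↦ avg_le_of_le fun x ↦ ind_le_one _)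
      (by rwa [avg_comm, mul_div_cancel₀ _ two_ne_zero,
            ← avg_sumElim fun w ↦ ind (w ∈ A)])
      (fun y hy ↦ hι {x | Sum.elim x y ∈ A} hy)
    obtain ⟨S, hS⟩ := hκ {y | ∀ a, Sum.elim (l a) y ∈ A} hl
    refine ⟨⟨Sum.elim (fun i ↦ (l.idxFun i).elim (Sum.inr 0) Sum.inl)
      (fun i ↦ (S.idxFun i).map id Fin.succ), fun e ↦ ?_⟩, fun z ↦ ?_⟩
    · refine Fin.cases ?_ (fun e ↦ ?_) e
      · obtain ⟨i, hi⟩ := l.proper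
        exact ⟨Sum.inl i, by simp [hi]⟩
      · obtain ⟨i, hi⟩ := S.proper e
        exact ⟨Sum.inr i, by simp [hi]⟩
    · convert hS (fun e ↦ z e.succ) (z 0) using 1
      funext i
      rcases i with i | i
      · simp only [Subspace.apply_def, Sum.elim_inl, Line.apply_def]
        cases l.idxFun i <;> simp
      · simp only [Subspace.apply_def, Sum.elim_inr]
        cases S.idxFun i <;> simp

end FirstConsequences

/-! ### Insensitive sets -/

section Insensitive

variable {α ι κ η : Type*}

/-- Replace every occurrence of the extra letter by `a`. -/
def fill (a : α) (z : ι → Option α) : ι → Option α := fun i ↦ some ((z i).getD a)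

@[simp] lemma fill_fill (a : α) (z : ι → Option α) : fill a (fill a z) = fill a z := by
  funext i
  simp [fill]

lemma fill_subspace_fill (a : α) (S : Subspace η (Option α) ι) (z : η → Option α) :
    fill a (S (fill a z)) = fill a (S z) := by
  funext i
  simp only [fill, Subspace.apply_def]
  cases S.idxFun i <;> simp [fill]

lemma fill_sumElim (a : α) (x : ι → Option α) (y : κ → Option α) :
    fill a (Sum.elim x y) = Sum.elim (fill a x) (fill a y) := by
  funext i
  cases i <;> rfl

/-- A set of words is insensitive at `a` if membership does not change when the extra letter is
replaced by `a`. -/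
def Insensitive (a : α) (C : Set (ι → Option α)) : Prop := ∀ z, z ∈ C ↔ fill a z ∈ C

lemma Insensitive.preimage {a : α} {C : Set (ι → Option α)} (hC : Insensitive a C)
    (S : Subspace η (Option α) ι) : Insensitive a {z | S z ∈ C} := by
  intro z
  rw [Set.mem_ofPred_eq, Set.mem_ofPred_eq, hC, hC (S (fill a z)), fill_subspace_fill]

lemma Insensitive.slice_left {a : α} {C : Set (ι ⊕ κ → Option α)} (hC : Insensitive a C)
    (y : κ → Option α) : Insensitive a {x | Sum.elim x y ∈ C} := by
  intro x
  rw [Set.mem_ofPred_eq, Set.mem_ofPred_eq, hC, hC (Sum.elim (fill a x) y), fill_sumElim,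
    fill_sumElim, fill_fill]

lemma Insensitive.slice_right {a : α} {C : Set (ι ⊕ κ → Option α)} (hC : Insensitive a C)
    (x : ι → Option α) : Insensitive a {y | Sum.elim x y ∈ C} := by
  intro y
  rw [Set.mem_ofPred_eq, Set.mem_ofPred_eq, hC, hC (Sum.elim x (fill a y)), fill_sumElim,
    fill_sumElim, fill_fill]

end Insensitive

/-! ### A Ramsey theorem for lines -/

lemma exists_subspace_subset_or_lines_notMem_fin {α : Type} [Finite α] (m : ℕ) :
    ∀ (p : Type) [Finite p], ∃ (ι : Type) (_ : Finite ι), ∀ G : Set (ι → Option α),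
      (∃ S : Subspace p (Option α) ι, ∀ z, S z ∈ G) ∨
      ∃ U : Subspace (Fin m) α ι, ∀ l : Line α (Fin m), (compLine U l).idxFun ∉ G := by
  induction m with
  | zero =>
    intro p _
    refine ⟨Fin 0, inferInstance, fun G ↦ Or.inr ⟨⟨fun i ↦ i.elim0, fun i ↦ i.elim0⟩, fun l ↦ ?_⟩⟩
    obtain ⟨i, -⟩ := l.proper
    exact i.elim0
  | succ m ih =>
    intro p _
    obtain ⟨p', _, hp'⟩ := Subspace.exists_mono_in_high_dimension (Option α) α p
    obtain ⟨κ, _, hκ⟩ := ih p'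
    obtain ⟨n, _, hn⟩ := Subspace.exists_mono_in_high_dimension (Option α) Prop (κ ⊕ p)
    refine ⟨Option n, inferInstance, fun G ↦ ?_⟩
    obtain ⟨Q, c, hQ⟩ := hn fun t ↦ (fun i : Option n ↦ i.elim none t) ∈ G
    by_cases hc : c
    · left
      refine ⟨⟨fun i ↦ i.elim (Sum.inl none)
        fun j ↦ (Q.idxFun j).elim Sum.inl (Sum.elim (fun _ ↦ Sum.inl none) Sum.inr),
        fun e ↦ ?_⟩, fun z ↦ ?_⟩
      · obtain ⟨j, hj⟩ := Q.proper (Sum.inr e)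
        exact ⟨some j, by simp [hj]⟩
      · refine Set.mem_of_eq_of_mem (funext fun i ↦ ?_) ((hQ (Sum.elim (fun _ ↦ none) z)).mpr hc)
        rcases i with _ | j
        · simp [Subspace.apply_def]
        · simp only [Subspace.apply_def, Option.elim_some]
          rcases Q.idxFun j with b | (e | e) <;> simp
    let Q' : Subspace κ (Option α) n :=
      ⟨fun j ↦ (Q.idxFun j).elim Sum.inl (Sum.elim Sum.inr fun _ ↦ Sum.inl none), fun e ↦ by
        obtain ⟨j, hj⟩ := Q.proper (Sum.inl e)
        exact ⟨j, by simp [hj]⟩⟩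
    have hQ' : ∀ z, (fun i : Option n ↦ i.elim none (Q' z)) ∉ G := by
      intro z hz
      refine hc ((hQ (Sum.elim z fun _ ↦ none)).mp (Set.mem_of_eq_of_mem (funext fun i ↦ ?_) hz))
      rcases i with _ | j
      · rfl
      · simp only [Subspace.apply_def, Option.elim_some, Q']
        rcases Q.idxFun j with b | (e | e) <;> simp
    clear_value Q'
    rcases hκ {z | ∃ a, (fun i : Option n ↦ i.elim (some a)
      fun j ↦ (Q'.idxFun j).elim (fun b ↦ some (b.getD a)) z) ∈ G} with ⟨S, hS⟩ | ⟨U, hU⟩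
    · left
      choose f hf using hS
      obtain ⟨R, a, hR⟩ := hp' f
      refine ⟨⟨fun i ↦ i.elim (Sum.inl (some a)) fun j ↦
        (Q'.idxFun j).elim (fun b ↦ Sum.inl (some (b.getD a))) (compSubspace S R).idxFun,
        fun e ↦ ?_⟩, fun z ↦ ?_⟩
      · obtain ⟨k, hk⟩ := (compSubspace S R).proper e
        obtain ⟨j, hj⟩ := Q'.proper k
        exact ⟨some j, by simp [hj, hk]⟩
      · refine Set.mem_of_eq_of_mem (funext fun i ↦ ?_) (hf (R z))
        rcases i with _ | j
        · simp [Subspace.apply_def, hR]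
        · rw [hR]
          simp only [Subspace.apply_def, Option.elim_some]
          rcases Q'.idxFun j with b | e
          · simp
          · exact congrFun (compSubspace_apply S R z) e
    · right
      refine ⟨⟨fun i ↦ i.elim (Sum.inr 0) fun j ↦ (Q'.idxFun j).elim
        (fun b ↦ b.elim (Sum.inr 0) Sum.inl) fun e ↦ (U.idxFun e).map id Fin.succ,
        fun e ↦ ?_⟩, fun l ↦ ?_⟩
      · refine Fin.cases ⟨none, rfl⟩ (fun e ↦ ?_) e
        obtain ⟨k, hk⟩ := U.proper e
        obtain ⟨j, hj⟩ := Q'.proper k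
        exact ⟨some j, by simp [hj, hk]⟩
      · rcases h0 : l.idxFun 0 with _ | a
        · convert hQ' (fun e ↦ (U.idxFun e).elim some fun k ↦ l.idxFun k.succ) using 2
          funext i
          rcases i with _ | j
          · simp [compLine, h0]
          · simp only [compLine, Subspace.apply_def, Option.elim_some]
            rcases Q'.idxFun j with b | e
            · cases b <;> simp [h0]
            · cases h : U.idxFun e <;> simp [h]
        · have hl : ∃ k : Fin m, l.idxFun k.succ = none := by
            obtain ⟨k, hk⟩ := l.proper
            refine k.cases (fun hk ↦ ?_) (fun k hk ↦ ⟨k, hk⟩) hk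
            simp [h0] at hk
          refine fun hG ↦ hU ⟨fun k ↦ l.idxFun k.succ, hl⟩ ⟨a, ?_⟩
          refine Set.mem_of_eq_of_mem (funext fun i ↦ ?_) hG
          rcases i with _ | j
          · simp [compLine, h0]
          · simp only [compLine, Option.elim_some]
            rcases Q'.idxFun j with b | e
            · cases b <;> simp [h0]
            · cases h : U.idxFun e <;> simp [h]

/-- In a large dimension every set `G` of words over `Option α` either contains a subspace of
dimension `p` or misses every line of some `m`-dimensional subspace over `α`. -/
lemma exists_subspace_subset_or_lines_notMem (α m p : Type) [Finite α] [Finite m] [Finite p] :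
    ∃ (ι : Type) (_ : Finite ι), ∀ G : Set (ι → Option α),
      (∃ S : Subspace p (Option α) ι, ∀ z, S z ∈ G) ∨
      ∃ U : Subspace m α ι, ∀ l : Line α m, (compLine U l).idxFun ∉ G := by
  let f := Finite.equivFin m
  obtain ⟨ι, _, hι⟩ := exists_subspace_subset_or_lines_notMem_fin (α := α) (Nat.card m) p
  refine ⟨ι, ‹_›, fun G ↦ (hι G).imp_right fun ⟨U, hU⟩ ↦ ?_⟩
  let R : Subspace m α (Fin (Nat.card m)) := ⟨fun i ↦ Sum.inr (f.symm i), fun j ↦ ⟨f j, by simp⟩⟩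
  refine ⟨compSubspace U R, fun l hl ↦ hU (compLine R l) (Set.mem_of_eq_of_mem ?_ hl)⟩
  funext i
  simp only [compLine, compSubspace]
  cases U.idxFun i <;> rfl

/-! ### Dense insensitive sets -/

section Dense

variable {α : Type} [Finite α]

/-- The set of coordinates where a word avoids the extra letter. -/
def support {ι : Type} (z : ι → Option α) : Set ι := {i | z i ≠ none}

lemma exists_avg_ind_ncard_support_lt_le [Nonempty α] (n : ℕ) {ε : ℝ} (hε : 0 < ε) :
    ∃ M : ℕ, avg (fun z : Fin M → Option α ↦ ind ((support z).ncard < n)) ≤ ε := by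
  classical
  have := Fintype.ofFinite α
  let h : Option α → ℝ := fun c ↦ if c = none then 1 else 1 / 2
  set s : ℝ := ∑ c, h c with hs
  have hs' : s = 1 + Fintype.card α / 2 := by
    rw [hs, Fintype.sum_option]
    simp [h, div_eq_mul_inv]
  have hα : (0 : ℝ) < Fintype.card α := by exact_mod_cast Fintype.card_pos
  have hq : s / (Fintype.card α + 1) < 1 := by
    rw [div_lt_one (by positivity)]
    linarith
  have hq0 : 0 ≤ s / (Fintype.card α + 1) := div_nonneg (by rw [hs']; positivity) (by positivity)
  obtain ⟨M, hM⟩ := exists_pow_lt_of_lt_one (show 0 < ε / 2 ^ n by positivity) hq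
  refine ⟨M, ?_⟩
  have hprod : ∀ z : Fin M → Option α, ∏ i, h (z i) = (1 / 2) ^ (support z).ncard := by
    intro z
    rw [Set.ncard_eq_toFinset_card', Finset.prod_ite, Finset.prod_const_one, one_mul,
      Finset.prod_const]
    congr 2
    ext i
    rw [Set.mem_toFinset, Finset.mem_filter]
    exact and_iff_right (Finset.mem_univ i)
  have hle : ∀ z : Fin M → Option α,
      ind ((support z).ncard < n) ≤ 2 ^ n * ∏ i, h (z i) := by
    intro z
    rw [hprod]
    by_cases hz : (support z).ncard < n
    · rw [ind_of_true hz, one_div, inv_pow, ← div_eq_mul_inv, one_le_div (by positivity)]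
      exact pow_le_pow_right₀ one_le_two hz.le
    · rw [ind_of_false hz]
      positivity
  refine (avg_mono hle).trans ?_
  rw [avg_const_mul, avg_eq, ← Fintype.sum_pow, Fintype.card_fun, Fintype.card_option,
    Fintype.card_fin]
  push_cast
  rw [← div_pow]
  rw [lt_div_iff₀ (by positivity)] at hM
  rw [mul_comm]
  exact hM.le

lemma HasDensityLines.exists_insensitive_subspace (hα : HasDensityLines α) (a : α) (η : Type)
    [Finite η] {ε : ℝ} (hε : 0 < ε) :
    ∃ (ι : Type) (_ : Finite ι), ∀ C : Set (ι → Option α), Insensitive a C →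
      ε ≤ avg (fun z ↦ ind (z ∈ C)) → ∃ V : Subspace η (Option α) ι, ∀ z, V z ∈ C := by
  classical
  have : Nonempty α := ⟨a⟩
  obtain ⟨ι₀, _, hι₀⟩ := hα.exists_subspace (Nat.card η) (ε / 4) (by positivity)
  obtain ⟨M, hM⟩ := exists_avg_ind_ncard_support_lt_le (α := α) (Nat.card ι₀)
    (show 0 < ε / 4 by positivity)
  refine ⟨Fin M, inferInstance, fun C hC hdens ↦ ?_⟩
  by_contra! hV
  let e (F : Set (Fin M)) (x : F → α) : Fin M → Option α :=
    fun i ↦ if h : i ∈ F then some (x ⟨i, h⟩) else none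
  have he (F : Set (Fin M)) : Function.Injective (e F) := by
    intro x y hxy
    funext i
    simpa [e] using congrFun hxy i
  have hrange (F : Set (Fin M)) (z : Fin M → Option α) (hz : support z = F) :
      z ∈ Set.range (e F) := by
    subst hz
    refine ⟨fun i ↦ (z i).get (Option.isSome_iff_ne_none.mpr i.2), funext fun i ↦ ?_⟩
    by_cases hi : i ∈ support z
    · simp [e, hi]
    · simp only [e, hi, dif_neg, not_false_eq_true]
      simpa [support, eq_comm] using hi
  have hsupp (F : Set (Fin M)) (x : F → α) : support (e F x) = F := by
    ext i
    by_cases hi : i ∈ F <;> simp [support, e, hi]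
  have hsmall (F : Set (Fin M)) (hF : Nat.card ι₀ ≤ F.ncard) :
      avg (fun x : F → α ↦ ind (e F x ∈ C)) ≤ ε / 4 := by
    by_contra! hlt
    obtain ⟨S₀, hS₀⟩ := exists_subspace_avg_le (η := ι₀) (ι := F) (by rwa [Nat.card_coe_set_eq])
      fun x : F → α ↦ ind (e F x ∈ C)
    obtain ⟨S₁, hS₁⟩ := hι₀ {x | e F (S₀ x) ∈ C} (hlt.le.trans hS₀)
    let f := Finite.equivFin η
    let S : Subspace η α F := compSubspace (compSubspace S₀ S₁)
      ⟨fun i ↦ Sum.inr (f.symm i), fun j ↦ ⟨f j, by simp⟩⟩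
    have hS : ∀ x, e F (S x) ∈ C := fun x ↦ by simpa [S] using hS₁ _
    clear_value S
    let V : Subspace η (Option α) (Fin M) :=
      ⟨fun i ↦ if h : i ∈ F then (S.idxFun ⟨i, h⟩).map some id else Sum.inl none, fun j ↦ by
        obtain ⟨i, hi⟩ := S.proper j
        exact ⟨i, by simp [hi]⟩⟩
    obtain ⟨z, hz⟩ := hV V
    refine hz ?_
    rw [hC, ← fill_subspace_fill, ← hC]
    refine Set.mem_of_eq_of_mem (funext fun i ↦ ?_) (hS fun j ↦ (z j).getD a)
    by_cases hi : i ∈ F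
    · simp only [V, e, Subspace.apply_def, hi, dif_pos]
      rcases S.idxFun ⟨i, hi⟩ with b | j <;> simp [fill]
    · simp [V, e, Subspace.apply_def, hi]
  let 𝓕 : Finset (Set (Fin M)) := Finset.univ.filter fun F ↦ Nat.card ι₀ ≤ F.ncard
  have h𝓕 : ∀ F, F ∈ 𝓕 ↔ Nat.card ι₀ ≤ F.ncard := by simp [𝓕]
  have hle : ∀ z, ind (z ∈ C) ≤ ind ((support z).ncard < Nat.card ι₀) +
      ∑ F ∈ 𝓕,
        ind (z ∈ Set.range (e F)) * ind (z ∈ C) := by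
    intro z
    have hnn : ∀ F : Set (Fin M), 0 ≤ ind (z ∈ Set.range (e F)) * ind (z ∈ C) :=
      fun F ↦ mul_nonneg (ind_nonneg _) (ind_nonneg _)
    rcases lt_or_ge (support z).ncard (Nat.card ι₀) with h | h
    · rw [ind_of_true h]
      linarith [ind_le_one (z ∈ C), Finset.sum_nonneg (s := 𝓕) fun F _ ↦ hnn F]
    · have := Finset.single_le_sum (f := fun F : Set (Fin M) ↦
        ind (z ∈ Set.range (e F)) * ind (z ∈ C)) (fun F _ ↦ hnn F)
        ((h𝓕 (support z)).mpr h)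
      rw [ind_of_true (hrange _ z rfl), one_mul] at this
      linarith [ind_nonneg ((support z).ncard < Nat.card ι₀)]
  have hterm : ∀ F ∈ 𝓕,
      avg (fun z ↦ ind (z ∈ Set.range (e F)) * ind (z ∈ C)) ≤
        ε / 4 * avg (fun z : Fin M → Option α ↦ ind (support z = F)) := by
    intro F hF
    have h1 : avg (fun z : Fin M → Option α ↦ ind (support z = F)) =
        avg (fun z ↦ ind (z ∈ Set.range (e F)) * 1) := by
      congr 1
      funext z
      rw [mul_one]
      congr 1
      exact propext ⟨hrange F z, fun ⟨x, hx⟩ ↦ hx ▸ hsupp F x⟩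
    rw [h1, avg_ind_range_mul (he F), avg_ind_range_mul (he F), avg_const, mul_one, mul_comm]
    gcongr
    exact hsmall F ((h𝓕 F).mp hF)
  have hsum : ∑ F ∈ 𝓕,
      avg (fun z : Fin M → Option α ↦ ind (support z = F)) ≤ 1 := by
    rw [← avg_sum]
    refine avg_le_of_le fun z ↦ ?_
    refine (Finset.sum_le_sum_of_subset_of_nonneg (Finset.filter_subset _ _)
      fun _ _ _ ↦ ind_nonneg _).trans ?_
    rw [Finset.sum_eq_single (support z) (fun F _ hF ↦ ind_of_false (Ne.symm hF)) (by simp)]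
    exact ind_le_one _
  have := avg_mono hle
  rw [avg_add, avg_sum] at this
  have h2 := Finset.sum_le_sum hterm
  rw [← Finset.mul_sum] at h2
  nlinarith

end Dense

/-! ### Averages over insensitive sets -/

section Averages

variable {α : Type} [Finite α]

/-- Split the average over `C` along a product `Set.range V ×ˢ Y` contained in `C`. -/
lemma avg_ind_mul_eq_add {β ι κ η : Type} [Finite β] [Finite ι] [Finite κ] [Finite η]
    (V : Subspace η β ι) (Y : Set (κ → β)) (C : Set (ι ⊕ κ → β))
    (hY : ∀ y ∈ Y, ∀ z, Sum.elim (V z) y ∈ C) (f : (ι ⊕ κ → β) → ℝ) :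
    avg (fun w ↦ ind (w ∈ C) * f w) =
      avg (fun x ↦ avg fun y ↦
        ind (Sum.elim x y ∈ C ∧ ¬(x ∈ Set.range V ∧ y ∈ Y)) * f (Sum.elim x y)) +
      avg (fun y ↦ ind (y ∈ Y) * ((Nat.card (η → β) / Nat.card (ι → β) : ℝ) *
        avg fun z ↦ f (Sum.elim (V z) y))) := by
  have h : ∀ x y, ind (Sum.elim x y ∈ C) * f (Sum.elim x y) =
      ind (Sum.elim x y ∈ C ∧ ¬(x ∈ Set.range V ∧ y ∈ Y)) * f (Sum.elim x y) +
      ind (y ∈ Y) * (ind (x ∈ Set.range V) * f (Sum.elim x y)) := by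
    intro x y
    by_cases hx : x ∈ Set.range V
    · by_cases hy : y ∈ Y
      · obtain ⟨z, rfl⟩ := hx
        simp [ind, hY y hy z, hy]
      · rw [and_iff_left fun h ↦ hy h.2, ind_of_false hy, zero_mul, add_zero]
    · rw [and_iff_left fun h ↦ hx h.1, ind_of_false hx, zero_mul, mul_zero, add_zero]
  rw [avg_sumElim]
  simp_rw [h, avg_add]
  congr 1
  rw [avg_comm]
  simp_rw [avg_const_mul, avg_ind_range_mul (subspace_injective V)]

lemma HasDensityLines.avg_insensitive_le (hα : HasDensityLines α) (a : α) (η : Type)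
    [Finite η] {ε : ℝ} (hε : 0 < ε) :
    ∃ (ι : Type) (_ : Finite ι), ∀ g : (ι → Option α) → ℝ, (∀ z, g z ≤ 1) →
      (∀ V : Subspace η (Option α) ι, avg (fun z ↦ g (V z)) ≤ 0) →
      ∀ C, Insensitive a C → avg (fun z ↦ ind (z ∈ C) * g z) ≤ ε := by
  obtain ⟨ι₀, _, hι₀⟩ := hα.exists_insensitive_subspace a η (show 0 < ε / 4 by positivity)
  set θ : ℝ := ε / 4 / (Nat.card (Subspace η (Option α) ι₀) + 1) with hθ
  set c : ℝ := Nat.card (η → Option α) / Nat.card (ι₀ → Option α) with hc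
  have hc0 : 0 < c := div_pos (by exact_mod_cast Nat.card_pos) (by exact_mod_cast Nat.card_pos)
  have hθ0 : 0 < θ := by positivity
  set ρ : ℝ := min 1 (c * θ) with hρ
  have hρ0 : 0 < ρ := lt_min one_pos (by positivity)
  have hρ1 : ρ ≤ 1 := min_le_left _ _
  have hρ2 : ρ ≤ c * θ := min_le_right _ _
  have key : ∀ j : ℕ, ∃ (ι : Type) (_ : Finite ι), ∀ g : (ι → Option α) → ℝ, (∀ z, g z ≤ 1) →
      (∀ V : Subspace η (Option α) ι, avg (fun z ↦ g (V z)) ≤ 0) →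
      ∀ C, Insensitive a C → avg (fun z ↦ ind (z ∈ C) * g z) ≤
        ε / 2 + (1 - ρ) ^ j * avg fun z ↦ ind (z ∈ C) := by
    intro j
    have htriv : ∀ (ι : Type) [Finite ι] (g : (ι → Option α) → ℝ), (∀ z, g z ≤ 1) →
        ∀ C : Set (ι → Option α), avg (fun z ↦ ind (z ∈ C) * g z) ≤ avg fun z ↦ ind (z ∈ C) :=
      fun ι _ g hg C ↦ avg_mono fun z ↦ mul_le_of_le_one_right (ind_nonneg _) (hg z)
    induction j with
    | zero =>
      refine ⟨Unit, inferInstance, fun g hg _ C _ ↦ ?_⟩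
      linarith [htriv _ g hg C]
    | succ j ih =>
      obtain ⟨κ, _, hκ⟩ := ih
      refine ⟨ι₀ ⊕ κ, inferInstance, fun g hg hgV C hC ↦ ?_⟩
      have hq : 0 ≤ (1 - ρ) ^ j := pow_nonneg (by linarith) j
      rcases lt_or_ge (avg fun z ↦ ind (z ∈ C)) (ε / 2) with hdens | hdens
      · have h0 : 0 ≤ (1 - ρ) ^ (j + 1) * avg fun z ↦ ind (z ∈ C) :=
          mul_nonneg (pow_nonneg (by linarith) _) (avg_nonneg fun _ ↦ ind_nonneg _)
        linarith [htriv _ g hg C]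
      obtain ⟨V, hV⟩ := exists_popular
        (fun (V : Subspace η (Option α) ι₀) (y : κ → Option α) ↦ ∀ z, Sum.elim (V z) y ∈ C)
        (fun y ↦ avg fun x ↦ ind (Sum.elim x y ∈ C)) (δ := ε / 4) (by positivity)
        (fun y ↦ avg_le_of_le fun x ↦ ind_le_one _)
        (by rw [avg_comm, ← avg_sumElim fun w ↦ ind (w ∈ C)]; linarith)
        (fun y hy ↦ hι₀ {x | Sum.elim x y ∈ C} (hC.slice_left y) hy)
      set Y : Set (κ → Option α) := {y | ∀ z, Sum.elim (V z) y ∈ C} with hY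
      have hYins : Insensitive a Y := fun y ↦ forall_congr' fun z ↦ hC.slice_right (V z) y
      let C' (x : ι₀ → Option α) : Set (κ → Option α) :=
        {y | Sum.elim x y ∈ C ∧ ¬(x ∈ Set.range V ∧ y ∈ Y)}
      have hC' (x) : Insensitive a (C' x) := fun y ↦
        and_congr (hC.slice_right x y) (not_congr (and_congr_right fun _ ↦ hYins y))
      have hsplit := avg_ind_mul_eq_add V Y C fun y hy ↦ hy
      have h1 : avg (fun x ↦ avg fun y ↦ ind (y ∈ C' x) * g (Sum.elim x y)) ≤
          ε / 2 + (1 - ρ) ^ j * avg fun x ↦ avg fun y ↦ ind (y ∈ C' x) := by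
        rw [← avg_const_mul, ← avg_const (Ω := ι₀ → Option α) (ε / 2), ← avg_add]
        refine avg_mono fun x ↦ ?_
        refine hκ (fun y ↦ g (Sum.elim x y)) (fun y ↦ hg _) (fun W ↦ ?_) (C' x) (hC' x)
        simpa using hgV (vertical x W)
      have h2 : avg (fun y ↦ ind (y ∈ Y) * (c * avg fun z ↦ g (Sum.elim (V z) y))) ≤ 0 := by
        refine avg_le_of_le fun y ↦ mul_nonpos_of_nonneg_of_nonpos (ind_nonneg _)
          (mul_nonpos_of_nonneg_of_nonpos hc0.le ?_)
        simpa using hgV (horizontal V y)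
      have h3 := hsplit fun _ ↦ 1
      simp only [mul_one, avg_const, avg_mul_const] at h3
      have h4 : avg (fun z ↦ ind (z ∈ C)) ≤ 1 := avg_le_of_le fun z ↦ ind_le_one _
      have h5 : θ * c ≤ avg (fun y ↦ ind (y ∈ Y)) * c := by gcongr; exact hV
      have h6 : avg (fun x ↦ avg fun y ↦ ind (y ∈ C' x)) ≤
          (1 - ρ) * avg fun z ↦ ind (z ∈ C) := by
        have : avg (fun z ↦ ind (z ∈ C)) = avg (fun x ↦ avg fun y ↦ ind (y ∈ C' x)) +
          avg (fun y ↦ ind (y ∈ Y)) * c := h3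
        nlinarith
      have h7 : avg (fun w ↦ ind (w ∈ C) * g w) ≤
          ε / 2 + (1 - ρ) ^ j * avg fun x ↦ avg fun y ↦ ind (y ∈ C' x) :=
        (hsplit g).trans_le ((add_le_add h1 h2).trans_eq (add_zero _))
      have h8 := mul_le_mul_of_nonneg_left h6 hq
      rw [pow_succ]
      linarith
  obtain ⟨j, hj⟩ := exists_pow_lt_of_lt_one (show 0 < ε / 2 by positivity)
    (show 1 - ρ < 1 by linarith)
  obtain ⟨ι, _, hι⟩ := key j
  refine ⟨ι, ‹_›, fun g hg hgV C hC ↦ (hι g hg hgV C hC).trans ?_⟩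
  have h1 : (1 - ρ) ^ j * avg (fun z ↦ ind (z ∈ C)) ≤ (1 - ρ) ^ j :=
    mul_le_of_le_one_right (pow_nonneg (by linarith) _) (avg_le_of_le fun z ↦ ind_le_one _)
  linarith

lemma HasDensityLines.avg_biInter_insensitive_le (hα : HasDensityLines α) (T : Finset α)
    (η : Type) [Finite η] {ε : ℝ} (hε : 0 < ε) :
    ∃ (ι : Type) (_ : Finite ι), ∀ g : (ι → Option α) → ℝ, (∀ z, g z ≤ 1) →
      (∀ V : Subspace η (Option α) ι, avg (fun z ↦ g (V z)) ≤ 0) →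
      ∀ C : α → Set (ι → Option α), (∀ a, Insensitive a (C a)) →
        avg (fun z ↦ ind (∀ a ∈ T, z ∈ C a) * g z) ≤ ε := by
  classical
  induction T using Finset.induction_on generalizing ε with
  | empty =>
    refine ⟨η, ‹_›, fun g _ hgV C _ ↦ ?_⟩
    obtain ⟨S, hS⟩ := exists_subspace_avg_le le_rfl g
    simpa [ind_of_true] using (hS.trans (hgV S)).trans hε.le
  | insert a T _ ih =>
    obtain ⟨κ, _, hκ⟩ := ih (ε := ε / 2) (by positivity)
    obtain ⟨ι, _, hι⟩ := hα.avg_insensitive_le a κ (show 0 < ε / 2 by positivity)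
    refine ⟨ι, ‹_›, fun g hg hgV C hC ↦ ?_⟩
    have h := hι (fun z ↦ ind (∀ b ∈ T, z ∈ C b) * g z - ε / 2)
      (fun z ↦ by
        have := mul_le_of_le_one_right (ind_nonneg (∀ b ∈ T, z ∈ C b)) (hg z)
        linarith [ind_le_one (∀ b ∈ T, z ∈ C b)])
      (fun V ↦ by
        rw [avg_sub, avg_const, sub_nonpos]
        exact hκ (fun z ↦ g (V z)) (fun z ↦ hg _)
          (fun W ↦ by simpa using hgV (compSubspace V W)) (fun b ↦ {z | V z ∈ C b})
          fun b ↦ (hC b).preimage V) (C a) (hC a)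
    have h1 : ∀ z, ind (∀ b ∈ insert a T, z ∈ C b) * g z ≤
        ind (z ∈ C a) * (ind (∀ b ∈ T, z ∈ C b) * g z - ε / 2) + ε / 2 := by
      intro z
      rw [Finset.forall_mem_insert, ind_and]
      nlinarith [ind_le_one (z ∈ C a)]
    refine (avg_mono h1).trans ?_
    rw [avg_add, avg_const]
    linarith

end Averages

/-! ### The density increment -/

section Increment

/-- A set of words contains a combinatorial line. -/
def ContainsLine {β ι : Type} (A : Set (ι → β)) : Prop := ∃ l : Line β ι, ∀ b, l b ∈ A

lemma ContainsLine.of_subspace {β ι η : Type} {A : Set (ι → β)} (S : Subspace η β ι)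
    (h : ContainsLine {z | S z ∈ A}) : ContainsLine A := by
  obtain ⟨l, hl⟩ := h
  exact ⟨compLine S l, fun b ↦ by simpa using hl b⟩

lemma ContainsLine.of_slice_left {β ι κ : Type} {A : Set (ι ⊕ κ → β)} {y : κ → β}
    (h : ContainsLine {x | Sum.elim x y ∈ A}) : ContainsLine A := by
  obtain ⟨l, hl⟩ := h
  exact ⟨l.horizontal y, fun b ↦ by simpa using hl b⟩

lemma ContainsLine.of_slice_right {β ι κ : Type} {A : Set (ι ⊕ κ → β)} {x : ι → β}
    (h : ContainsLine {y | Sum.elim x y ∈ A}) : ContainsLine A := by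
  obtain ⟨l, hl⟩ := h
  exact ⟨l.vertical x, fun b ↦ by simpa using hl b⟩

/-- A word containing the extra letter, together with its fillings, forms a line. -/
lemma containsLine_of_fill {α ι : Type} {A : Set (ι → Option α)} {w : ι → Option α}
    (hw : ∃ i, w i = none) (h : w ∈ A) (hfill : ∀ a, fill a w ∈ A) : ContainsLine A := by
  refine ⟨⟨fun i ↦ (w i).map some, by simpa using hw⟩, fun b ↦ ?_⟩
  rcases b with _ | a
  · refine Set.mem_of_eq_of_mem (funext fun i ↦ ?_) h
    cases hi : w i <;> simp [hi]
  · refine Set.mem_of_eq_of_mem (funext fun i ↦ ?_) (hfill a)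
    cases hi : w i <;> simp [fill, hi]

/-- A function whose average is close to its upper bound is never much smaller. -/
lemma sub_le_of_sub_le_avg {Ω : Type*} [Finite Ω] [Nonempty Ω] {f : Ω → ℝ} {δ ε : ℝ}
    (h : δ - ε ≤ avg f) (hf : ∀ x, f x ≤ δ + ε) (x : Ω) :
    δ + ε - 2 * Nat.card Ω * ε ≤ f x := by
  have := Fintype.ofFinite Ω
  rw [avg_eq, le_div_iff₀ (by exact_mod_cast Fintype.card_pos)] at h
  have h1 := Finset.single_le_sum (f := fun x ↦ δ + ε - f x) (fun x _ ↦ sub_nonneg.mpr (hf x))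
    (Finset.mem_univ x)
  simp only [Finset.sum_sub_distrib, Finset.sum_const, Finset.card_univ, nsmul_eq_mul] at h1
  rw [Nat.card_eq_fintype_card]
  linarith

variable {α : Type} [Finite α]

/-- If `A` is disjoint from the intersection of the `D a`, its excess density is seen by one of
the cells that the sets `D a` generate. -/
lemma avg_sub_mul_ind_le {ι : Type} [Finite ι] [Nonempty ι] {A : Set ι} {D : α → Set ι}
    (hAD : ∀ z ∈ A, ¬∀ a, z ∈ D a) (c ε : ℝ) (hε : 0 ≤ ε)
    (h : ∀ s : Set α, avg (fun z ↦ ind (∀ a, z ∈ D a ↔ a ∈ s) * (ind (z ∈ A) - c)) ≤ ε) :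
    avg (fun z ↦ ind (z ∈ A) - c * (1 - ind (∀ a, z ∈ D a))) ≤ Nat.card (Set α) * ε := by
  classical
  have := Fintype.ofFinite (Set α)
  have key : ∀ z, ind (z ∈ A) - c * (1 - ind (∀ a, z ∈ D a)) =
      ∑ s ∈ Finset.univ.erase (Set.univ : Set α),
        ind (∀ a, z ∈ D a ↔ a ∈ s) * (ind (z ∈ A) - c) := by
    intro z
    by_cases hz : ∀ a, z ∈ D a
    · have hA : z ∉ A := fun hA ↦ hAD z hA hz
      rw [ind_of_true hz, ind_of_false hA, Finset.sum_eq_zero]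
      · simp
      · intro s hs
        rw [ind_of_false, zero_mul]
        intro hs'
        exact (Finset.mem_erase.mp hs).1 (Set.eq_univ_of_forall fun a ↦ (hs' a).mp (hz a))
    · rw [ind_of_false hz, Finset.sum_eq_single {a | z ∈ D a}]
      · rw [ind_of_true (p := ∀ a, z ∈ D a ↔ a ∈ {a | z ∈ D a}) fun a ↦ Iff.rfl]
        ring
      · intro s _ hs
        rw [ind_of_false fun h ↦ hs (Set.ext fun a ↦ (h a).symm), zero_mul]
      · intro hs
        exact absurd (Finset.mem_erase.mpr ⟨fun h ↦ hz fun a ↦ Set.eq_univ_iff_forall.mp h a,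
          Finset.mem_univ _⟩) hs
  simp_rw [key]
  rw [avg_sum]
  refine (Finset.sum_le_sum fun s _ ↦ h s).trans ?_
  rw [Finset.sum_const, nsmul_eq_mul, Nat.card_eq_fintype_card]
  gcongr
  exact Finset.card_le_univ _

/-- No density is critical for the alphabet `Option α`. -/
lemma HasDensityLines.not_critical [Nonempty α] (hα : HasDensityLines α) {δ : ℝ} (hδ : 0 < δ)
    (hupper : ∀ ε > 0, ∃ (ι : Type) (_ : Finite ι), ∀ A : Set (ι → Option α), ¬ContainsLine A →
      avg (fun w ↦ ind (w ∈ A)) ≤ δ + ε)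
    (hlower : ∀ ε > 0, ∀ (ι : Type) [Finite ι], ∃ A : Set (ι → Option α), ¬ContainsLine A ∧
      δ - ε ≤ avg (fun w ↦ ind (w ∈ A))) : False := by
  have := Fintype.ofFinite α
  obtain ⟨m, _, θ, hθ, hm⟩ := hα.exists_dense_line (half_pos hδ)
  set γ := δ * θ / 3 with hγ
  have hγ0 : 0 < γ := by positivity
  obtain ⟨η, _, hη⟩ := hupper γ hγ0
  have hcard : (0 : ℝ) < Nat.card (Set α) := by exact_mod_cast Nat.card_pos
  obtain ⟨p, _, hp⟩ := hα.avg_biInter_insensitive_le Finset.univ η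
    (show 0 < γ / (2 * Nat.card (Set α)) by positivity)
  obtain ⟨ι, _, hι⟩ := exists_subspace_subset_or_lines_notMem α m (Option p)
  have hcard' : (0 : ℝ) < Nat.card (ι → Option α) := by exact_mod_cast Nat.card_pos
  set ε := min γ (δ / 2) / (2 * Nat.card (ι → Option α)) with hε
  have hε0 : 0 < ε := div_pos (lt_min hγ0 (half_pos hδ)) (by positivity)
  obtain ⟨κ, _, hκ⟩ := hupper ε hε0
  obtain ⟨A, hA, hdens⟩ := hlower ε hε0 (ι ⊕ κ)
  rw [avg_sumElim] at hdens
  have hslice : ∀ x : ι → Option α, δ - min γ (δ / 2) ≤ avg fun y ↦ ind (Sum.elim x y ∈ A) := by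
    intro x
    have h1 := sub_le_of_sub_le_avg hdens
      (fun x ↦ hκ {y | Sum.elim x y ∈ A} fun h ↦ hA h.of_slice_right) x
    have h2 : 2 * Nat.card (ι → Option α) * ε = min γ (δ / 2) := by
      rw [hε]
      field_simp
    linarith
  obtain ⟨S, hS⟩ | ⟨U, hU⟩ := hι {w | θ ≤ avg fun y ↦ ind (∀ a, Sum.elim (fill a w) y ∈ A)}
  swap
  · obtain ⟨l, hl⟩ := hm (κ → Option α) (fun x ↦ {y | Sum.elim (fun i ↦ some (U x i)) y ∈ A})
      fun x ↦ by
        have := hslice fun i ↦ some (U x i)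
        exact le_trans (by linarith [min_le_right γ (δ / 2)]) this
    refine hU l (hl.trans_eq (congrArg avg (funext fun y ↦ congrArg ind (propext
      (forall_congr' fun a ↦ ?_)))))
    have : fill a (compLine U l).idxFun = fun i ↦ some (U (l a) i) := by
      rw [← compLine_apply]
      rfl
    rw [this]
    rfl
  let R : Subspace p (Option α) (Option p) :=
    ⟨fun o ↦ o.elim (Sum.inl none) Sum.inr, fun e ↦ ⟨some e, rfl⟩⟩
  obtain ⟨S', hS', hstar⟩ : ∃ S' : Subspace p (Option α) ι,
      (∀ z, θ ≤ avg fun y ↦ ind (∀ a, Sum.elim (fill a (S' z)) y ∈ A)) ∧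
      ∀ z, ∃ i, S' z i = none := by
    refine ⟨compSubspace S R, fun z ↦ ?_, fun z ↦ ?_⟩
    · rw [compSubspace_apply]
      exact hS _
    · obtain ⟨i, hi⟩ := S.proper none
      refine ⟨i, ?_⟩
      rw [compSubspace_apply, Subspace.apply_inr hi]
      rfl
  have hbig : γ ≤ avg fun y ↦ avg fun z ↦ ind (Sum.elim (S' z) y ∈ A) -
      (δ + γ) * (1 - ind (∀ a, Sum.elim (fill a (S' z)) y ∈ A)) := by
    rw [avg_comm]
    refine le_avg_of_le fun z ↦ ?_
    rw [avg_sub, avg_const_mul, avg_sub, avg_const]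
    have h1 := hslice (S' z)
    have h2 := min_le_left γ (δ / 2)
    have h3 : θ * (δ + γ) ≤ avg (fun y ↦ ind (∀ a, Sum.elim (fill a (S' z)) y ∈ A)) * (δ + γ) := by
      gcongr
      exact hS' z
    nlinarith [mul_pos hθ hγ0]
  obtain ⟨y, hy⟩ := exists_le_of_le_avg hbig
  have hcell := avg_sub_mul_ind_le (A := {z | Sum.elim (S' z) y ∈ A})
    (D := fun a ↦ {z | Sum.elim (fill a (S' z)) y ∈ A})
    (fun z hz hD ↦ hA (ContainsLine.of_slice_left (containsLine_of_fill (hstar z) hz hD)))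
    (δ + γ) (γ / (2 * Nat.card (Set α))) (by positivity) fun s ↦ ?_
  · have h1 : Nat.card (Set α) * (γ / (2 * Nat.card (Set α))) = γ / 2 := by field_simp
    rw [h1] at hcell
    have := hy.trans hcell
    linarith
  · have h := hp (fun z ↦ ind (Sum.elim (S' z) y ∈ A) - (δ + γ))
      (fun z ↦ by linarith [ind_le_one (Sum.elim (S' z) y ∈ A)])
      (fun V ↦ by
        rw [avg_sub, avg_const, sub_nonpos]
        exact hη {z | Sum.elim (S' (V z)) y ∈ A} fun h ↦ hA (ContainsLine.of_slice_left
          ((h.of_subspace (A := {z | Sum.elim (S' z) y ∈ A}) V).of_subspace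
            (A := {x | Sum.elim x y ∈ A}) S')))
      (fun a ↦ {z | Sum.elim (fill a (S' z)) y ∈ A ↔ a ∈ s})
      (fun a z ↦ by
        rw [Set.mem_ofPred_eq, Set.mem_ofPred_eq, fill_subspace_fill])
    simpa using h

lemma HasDensityLines.option [Nonempty α] (hα : HasDensityLines α) :
    HasDensityLines (Option α) := by
  by_contra hnot
  obtain ⟨δ₀, hδ₀, hcounter⟩ : ∃ δ₀ : ℝ, 0 < δ₀ ∧ ∀ (ι : Type) [Finite ι],
      ∃ A : Set (ι → Option α), ¬ContainsLine A ∧ δ₀ ≤ avg (fun w ↦ ind (w ∈ A)) := by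
    unfold HasDensityLines at hnot
    push Not at hnot
    obtain ⟨δ₀, hδ₀, h⟩ := hnot
    refine ⟨δ₀, hδ₀, fun ι _ ↦ ?_⟩
    obtain ⟨A, hA, hl⟩ := h ι ‹_›
    exact ⟨A, fun ⟨l, hl'⟩ ↦ (hl l).elim fun b hb ↦ hb (hl' b), hA⟩
  set P : Set ℝ := {c | ∃ (ι : Type) (_ : Finite ι), ∀ A : Set (ι → Option α), ¬ContainsLine A →
    avg (fun w ↦ ind (w ∈ A)) ≤ c} with hP
  have hP1 : (1 : ℝ) ∈ P := ⟨Unit, inferInstance, fun A _ ↦ avg_le_of_le fun _ ↦ ind_le_one _⟩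
  have hPδ₀ : ∀ c ∈ P, δ₀ ≤ c := by
    rintro c ⟨ι, _, hι⟩
    obtain ⟨A, hA, hdens⟩ := hcounter ι
    exact hdens.trans (hι A hA)
  refine hα.not_critical (hδ₀.trans_le (le_csInf ⟨1, hP1⟩ hPδ₀)) (fun ε hε ↦ ?_)
    fun ε hε ι _ ↦ ?_
  · obtain ⟨c, ⟨ι, hfin, hι⟩, hc⟩ :=
      exists_lt_of_csInf_lt ⟨1, hP1⟩ (lt_add_of_pos_right (sInf P) hε)
    exact ⟨ι, hfin, fun A hA ↦ (hι A hA).trans hc.le⟩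
  · by_contra! h
    have := csInf_le ⟨δ₀, hPδ₀⟩ (show sInf P - ε ∈ P from ⟨ι, ‹_›, fun A hA ↦ (h A hA).le⟩)
    linarith

lemma hasDensityLines_of_subsingleton (α : Type) [Finite α] [Subsingleton α] :
    HasDensityLines α := by
  intro δ hδ
  refine ⟨Unit, inferInstance, fun A hA ↦ ?_⟩
  obtain ⟨w, hw⟩ := exists_mem_of_avg_pos (hδ.trans_le hA)
  exact ⟨⟨fun _ ↦ none, (), rfl⟩, fun a ↦ Set.mem_of_eq_of_mem (Subsingleton.elim _ _) hw⟩

lemma HasDensityLines.of_equiv {β : Type} [Finite β] (e : α ≃ β) (hα : HasDensityLines α) :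
    HasDensityLines β := by
  intro δ hδ
  obtain ⟨ι, _, hι⟩ := hα δ hδ
  refine ⟨ι, ‹_›, fun A hA ↦ ?_⟩
  obtain ⟨l, hl⟩ := hι {w | e ∘ w ∈ A}
    (hA.trans_eq (avg_equiv ((Equiv.refl ι).arrowCongr e) fun w ↦ ind (w ∈ A)).symm)
  refine ⟨l.map e, e.forall_congr_right.mp fun a ↦ ?_⟩
  rw [Line.map_apply]
  exact hl a

/-- The density Hales-Jewett theorem. -/
theorem hasDensityLines (k : ℕ) : HasDensityLines (Fin k) := by
  rcases k with _ | k
  · exact hasDensityLines_of_subsingleton _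
  induction k with
  | zero => exact hasDensityLines_of_subsingleton (Fin 1)
  | succ k ih => exact ih.option.of_equiv (finSuccEquiv _).symm

end Increment

/-! ### Families of events and sums along lines -/

lemma exists_sum_line_eq {α ι G : Type*} [Fintype ι] [AddCommGroup G] (v : α → G) (l : Line α ι) :
    ∃ r : ℕ, 0 < r ∧ ∃ c : G, ∀ a, ∑ i, v (l a i) = c + (r : ℤ) • v a := by
  classical
  obtain ⟨i₀, hi₀⟩ := l.proper
  refine ⟨(Finset.univ.filter fun i ↦ l.idxFun i = none).card,
    Finset.card_pos.mpr ⟨i₀, by simp [hi₀]⟩, ∑ i, (l.idxFun i).elim 0 v, fun a ↦ ?_⟩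
  rw [natCast_zsmul, ← Finset.sum_const, Finset.sum_filter, ← Finset.sum_add_distrib]
  refine Finset.sum_congr rfl fun i _ ↦ ?_
  cases h : l.idxFun i <;> simp [h]

/-- Events of measure at least `δ` indexed by words have positive intersection along a line. -/
lemma exists_line_measure_iInter_pos {α ι X : Type*} [Finite α] [Nonempty α] [Finite ι]
    [MeasurableSpace X] (μ : Measure X) [IsProbabilityMeasure μ] {δ : ℝ}
    (hι : ∀ A : Set (ι → α), δ ≤ avg (fun w ↦ ind (w ∈ A)) → ∃ l : Line α ι, ∀ a, l a ∈ A)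
    (F : (ι → α) → Set X) (hF : ∀ w, MeasurableSet (F w)) (hδ : ∀ w, δ ≤ μ.real (F w)) :
    ∃ l : Line α ι, 0 < μ (⋂ a, F (l a)) := by
  have := Fintype.ofFinite (ι → α)
  have hind (w : ι → α) : (fun x ↦ ind (x ∈ F w)) = (F w).indicator 1 := by
    funext x
    by_cases hx : x ∈ F w <;> simp [ind, hx]
  have hint (w : ι → α) : Integrable (fun x ↦ ind (x ∈ F w)) μ := by
    rw [hind]
    exact (integrable_const (1 : ℝ)).indicator (hF w)
  have hintegral (w : ι → α) : ∫ x, ind (x ∈ F w) ∂μ = μ.real (F w) := by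
    rw [hind, integral_indicator_one (hF w)]
  have hint' : Integrable (fun x ↦ avg fun w ↦ ind (x ∈ F w)) μ := by
    simp_rw [avg_eq]
    exact (integrable_finsetSum _ fun w _ ↦ hint w).div_const _
  have hle : δ ≤ ∫ x, avg (fun w ↦ ind (x ∈ F w)) ∂μ := by
    simp_rw [avg_eq]
    rw [integral_div, integral_finsetSum _ fun w _ ↦ hint w, ← avg_eq]
    exact le_avg_of_le fun w ↦ (hδ w).trans_eq (hintegral w).symm
  have hN : μ (⋃ l : {l : Line α ι // μ (⋂ a, F (l a)) = 0}, ⋂ a, F (l.1 a)) = 0 :=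
    measure_iUnion_null fun l ↦ l.2
  obtain ⟨x, hxN, hx⟩ := exists_notMem_null_integral_le hint' hN
  obtain ⟨l, hl⟩ := hι {w | x ∈ F w} (hle.trans hx)
  exact ⟨l, pos_iff_ne_zero.mpr fun h0 ↦
    hxN (Set.mem_iUnion.mpr ⟨⟨l, h0⟩, Set.mem_iInter.mpr hl⟩)⟩

end DensityHalesJewett

/-- **Multiple recurrence theorem** (Furstenberg–Katznelson). Given a `ℤ^d`-system,
i.e. a probability space `(X, μ)` together with measure-preserving bijections
`T h : X → X` for `h ∈ ℤ^d` satisfying `T (h + h') = T h ∘ T h'`, a set `E` of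
positive measure and `v 0, …, v (k-1) ∈ ℤ^d`, there is a natural number `r > 0`
with `μ (T (r • v 0) E ∩ … ∩ T (r • v (k-1)) E) > 0`. -/
theorem multiple_recurrence (d : ℕ) (hd : 1 ≤ d)
    {X : Type*} [MeasurableSpace X] (μ : Measure X) [IsProbabilityMeasure μ]
    (T : (Fin d → ℤ) → X → X)
    (hT : ∀ h, MeasurePreserving (T h) μ μ)
    (hTbij : ∀ h, Function.Bijective (T h))
    (hThom : ∀ h h', T (h + h') = T h ∘ T h')
    (E : Set X) (hE : MeasurableSet E) (hEpos : 0 < μ E)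
    (k : ℕ) (v : Fin k → Fin d → ℤ) :
    ∃ r : ℕ, 0 < r ∧ 0 < μ (⋂ j, T ((r : ℤ) • v j) '' E) := by
  rcases Nat.eq_zero_or_pos k with rfl | hk
  · exact ⟨1, one_pos, by simp⟩
  have : Nonempty (Fin k) := ⟨⟨0, hk⟩⟩
  have hzero (x : X) : T 0 x = x :=
    (hTbij 0).1 (by simpa using (congrFun (hThom 0 0) x).symm)
  have himage (h : Fin d → ℤ) (F : Set X) : T h '' F = T (-h) ⁻¹' F :=
    congrFun (Set.image_eq_preimage_of_inverse
      (fun x ↦ by simpa [hzero] using (congrFun (hThom (-h) h) x).symm)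
      (fun x ↦ by simpa [hzero] using (congrFun (hThom h (-h)) x).symm)) F
  have hmeas (h : Fin d → ℤ) {F : Set X} (hF : MeasurableSet F) : MeasurableSet (T h '' F) := by
    rw [himage]
    exact (hT _).measurable hF
  have hμ (h : Fin d → ℤ) {F : Set X} (hF : MeasurableSet F) : μ (T h '' F) = μ F := by
    rw [himage]
    exact (hT _).measure_preimage hF.nullMeasurableSet
  obtain ⟨ι, _, hι⟩ := DensityHalesJewett.hasDensityLines k (μ.real E)
    (ENNReal.toReal_pos hEpos.ne' (measure_ne_top μ E))
  have := Fintype.ofFinite ι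
  obtain ⟨l, hpos⟩ := DensityHalesJewett.exists_line_measure_iInter_pos μ hι
    (fun w ↦ T (∑ i, v (w i)) '' E) (fun w ↦ hmeas _ hE)
    fun w ↦ by rw [measureReal_def, measureReal_def, hμ _ hE]
  obtain ⟨r, hr, c, hc⟩ := DensityHalesJewett.exists_sum_line_eq v l
  refine ⟨r, hr, ?_⟩
  have hF : ⋂ a, T (∑ i, v (l a i)) '' E = T c '' ⋂ a, T ((r : ℤ) • v a) '' E := by
    rw [Set.image_iInter (hTbij c)]
    refine Set.iInter_congr fun a ↦ ?_
    rw [← Set.image_comp, ← hThom, ← hc]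
  rwa [hF, hμ c (MeasurableSet.iInter fun a ↦ hmeas _ hE)] at hpos
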